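/- Let Z be a positive weight operator with S_i Z − Z S_i compact for every letter i (Condition A(1)), and let T be the smallest closed star-subalgebra of B(H) containing {Z S_i : 1 ≤ i ≤ d} (so K ⊆ T and S_i, Z ∈ T). Let H' be a complex Hilbert space, U_1, …, U_d ∈ B(H'), and R ∈ B(H'). Then the following are equivalent: (i) there exists a unital star-algebra homomorphism π : T → B(H') vanishing on K with π(S_i) = U_i for every i and π(Z) = R; (ii) (U_i) is a Cuntz family (U_i* U_j = δ_{ij}·1 and Σ_{i=1}^d U_i U_i* = 1), R is positive and invertible, R U_i = U_i R for every i, and the spectrum of R is contained in the essential spectrum of Z, namely the set {λ ∈ ℂ : there is no V ∈ B(H) with both (Z − λ·1)V − 1 and V(Z − λ·1) − 1 compact}. -/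

import Mathlib

noncomputable section

instance (α : Type*) [DecidableEq α] : DecidableEq (FreeMonoid α) :=
  fun a b => inferInstanceAs (Decidable (a.toList = b.toList))

/-- The full Fock space of `ℂ^d`, modeled as `ℓ²` of the free monoid on `Fin d`. -/
abbrev FockSpace (d : ℕ) : Type := lp (fun _ : FreeMonoid (Fin d) => ℂ) 2

/-- The standard basis vector `e_α` of the Fock space. -/
noncomputable def fockBasis (d : ℕ) (α : FreeMonoid (Fin d)) : FockSpace d :=
  lp.single 2 α (1 : ℂ)

/-- `S_α = S_{α₁} ⋯ S_{αₙ}` for a word `α` (with `S_∅ = 1`). -/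
noncomputable def wordOp {d : ℕ} (S : Fin d → (FockSpace d →L[ℂ] FockSpace d))
    (α : FreeMonoid (Fin d)) : FockSpace d →L[ℂ] FockSpace d :=
  (α.toList.map S).prod

open ContinuousLinearMap Filter Topology

section AsymptoticIntertwiner

variable {E F : Type*} [NormedAddCommGroup E] [InnerProductSpace ℂ E]
  [NormedAddCommGroup F] [InnerProductSpace ℂ F]
  {K : ℕ → Type*} [∀ n, NormedAddCommGroup (K n)] [∀ n, NormedSpace ℂ (K n)]

/-- The maps `V n` asymptotically intertwine `Y` with the representations `ρ n X`. -/
def AsympIntertwines (ρ : ∀ n, (E →L[ℂ] E) →ₐ[ℂ] (K n →L[ℂ] K n)) (V : ∀ n, F →L[ℂ] K n)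
    (X : E →L[ℂ] E) (Y : F →L[ℂ] F) : Prop :=
  Tendsto (fun n => ‖ρ n X ∘L V n - V n ∘L Y‖) atTop (𝓝 0)

namespace AsympIntertwines

variable {ρ : ∀ n, (E →L[ℂ] E) →ₐ[ℂ] (K n →L[ℂ] K n)} {V : ∀ n, F →L[ℂ] K n}
  {X X' : E →L[ℂ] E} {Y Y' : F →L[ℂ] F}

theorem add (h : AsympIntertwines ρ V X Y) (h' : AsympIntertwines ρ V X' Y') :
    AsympIntertwines ρ V (X + X') (Y + Y') := by
  refine squeeze_zero (fun _ => norm_nonneg _) (fun n => ?_) (by simpa using Tendsto.add h h')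
  refine le_trans (le_of_eq ?_) (norm_add_le _ _)
  congr 1
  simp only [map_add, add_comp, comp_add]
  abel

theorem mul (hρ : ∀ n X, ‖ρ n X‖ ≤ ‖X‖) (h : AsympIntertwines ρ V X Y)
    (h' : AsympIntertwines ρ V X' Y') : AsympIntertwines ρ V (X * X') (Y * Y') := by
  refine squeeze_zero (fun _ => norm_nonneg _) (fun n => ?_)
    (by simpa using (Tendsto.const_mul ‖X‖ h').add (Tendsto.mul_const ‖Y'‖ h))
  have key : ρ n (X * X') ∘L V n - V n ∘L (Y * Y') =
      ρ n X ∘L (ρ n X' ∘L V n - V n ∘L Y') + (ρ n X ∘L V n - V n ∘L Y) ∘L Y' := by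
    ext x
    simp
  rw [key]
  refine (norm_add_le _ _).trans (add_le_add ?_ (opNorm_comp_le _ _))
  exact (opNorm_comp_le _ _).trans (mul_le_mul_of_nonneg_right (hρ n X) (norm_nonneg _))

theorem smul_one (c : ℂ) : AsympIntertwines ρ V (c • 1) (c • 1) := by
  have : ∀ n, ρ n (c • 1) ∘L V n - V n ∘L (c • (1 : F →L[ℂ] F)) = 0 := by
    intro n
    ext x
    simp
  simp only [AsympIntertwines, this, norm_zero, tendsto_const_nhds]

theorem sub (hρ : ∀ n X, ‖ρ n X‖ ≤ ‖X‖) (h : AsympIntertwines ρ V X Y)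
    (h' : AsympIntertwines ρ V X' Y') : AsympIntertwines ρ V (X - X') (Y - Y') := by
  have := h.add ((smul_one (-1)).mul hρ h')
  simpa [sub_eq_add_neg] using this

theorem norm_le (hρ : ∀ n X, ‖ρ n X‖ ≤ ‖X‖) (hV : ∀ n x, ‖V n x‖ = ‖x‖)
    (h : AsympIntertwines ρ V X Y) : ‖Y‖ ≤ ‖X‖ := by
  refine opNorm_le_bound _ (norm_nonneg _) fun y => ?_
  have hlim : Tendsto (fun n => ‖X‖ * ‖y‖ + ‖ρ n X ∘L V n - V n ∘L Y‖ * ‖y‖) atTop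
      (𝓝 (‖X‖ * ‖y‖)) := by
    simpa using (Tendsto.mul_const ‖y‖ h).const_add (‖X‖ * ‖y‖)
  refine ge_of_tendsto' hlim fun n => ?_
  calc ‖Y y‖ = ‖V n (Y y)‖ := (hV n _).symm
    _ = ‖ρ n X (V n y) - (ρ n X ∘L V n - V n ∘L Y) y‖ := by simp
    _ ≤ ‖ρ n X (V n y)‖ + ‖(ρ n X ∘L V n - V n ∘L Y) y‖ := norm_sub_le _ _
    _ ≤ _ := by
      refine add_le_add ?_ (le_opNorm _ _)
      refine (le_of_opNorm_le _ (hρ n X) _).trans_eq ?_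
      rw [hV]

theorem unique (hρ : ∀ n X, ‖ρ n X‖ ≤ ‖X‖) (hV : ∀ n x, ‖V n x‖ = ‖x‖)
    (h : AsympIntertwines ρ V X Y) (h' : AsympIntertwines ρ V X Y') : Y = Y' := by
  have := (h.sub hρ h').norm_le hρ hV
  rw [sub_self, norm_zero] at this
  exact sub_eq_zero.1 (norm_le_zero_iff.1 this)

theorem of_tendsto (hρ : ∀ n X, ‖ρ n X‖ ≤ ‖X‖) (hV : ∀ n x, ‖V n x‖ = ‖x‖)
    {x : ℕ → E →L[ℂ] E} {y : ℕ → F →L[ℂ] F} (hx : Tendsto x atTop (𝓝 X))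
    (hy : Tendsto y atTop (𝓝 Y)) (h : ∀ m, AsympIntertwines ρ V (x m) (y m)) :
    AsympIntertwines ρ V X Y := by
  have hV1 : ∀ n, ‖V n‖ ≤ 1 := fun n => opNorm_le_bound _ zero_le_one fun z => by simp [hV]
  rw [AsympIntertwines, Metric.tendsto_atTop]
  intro ε hε
  obtain ⟨m, hm1, hm2⟩ := ((Metric.tendsto_nhds.1 hx (ε / 3) (by positivity)).and
    (Metric.tendsto_nhds.1 hy (ε / 3) (by positivity))).exists
  obtain ⟨N, hN⟩ := Metric.tendsto_atTop.1 (h m) (ε / 3) (by positivity)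
  refine ⟨N, fun n hn => ?_⟩
  have h1 := hN n hn
  rw [dist_eq_norm] at hm1 hm2
  rw [Real.dist_eq, sub_zero, abs_norm] at h1 ⊢
  have key : ρ n X ∘L V n - V n ∘L Y =
      (ρ n (x m) ∘L V n - V n ∘L y m) - ρ n (x m - X) ∘L V n + V n ∘L (y m - Y) := by
    ext z
    simp
  have h2 : ‖ρ n (x m - X) ∘L V n‖ ≤ ‖x m - X‖ * 1 :=
    (opNorm_comp_le _ _).trans (mul_le_mul (hρ _ _) (hV1 n) (norm_nonneg _) (norm_nonneg _))
  have h3 : ‖V n ∘L (y m - Y)‖ ≤ 1 * ‖y m - Y‖ :=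
    (opNorm_comp_le _ _).trans (mul_le_mul_of_nonneg_right (hV1 n) (norm_nonneg _))
  rw [key]
  linarith [norm_add_le (ρ n (x m) ∘L V n - V n ∘L y m - ρ n (x m - X) ∘L V n) (V n ∘L (y m - Y)),
    norm_sub_le (ρ n (x m) ∘L V n - V n ∘L y m) (ρ n (x m - X) ∘L V n)]

variable [CompleteSpace E] [CompleteSpace F]

theorem exists_of_mem_adjoin (hρ : ∀ n X, ‖ρ n X‖ ≤ ‖X‖) {s : Set (E →L[ℂ] E)}
    (hs : ∀ X ∈ s, ∃ Y, AsympIntertwines ρ V X Y ∧ AsympIntertwines ρ V (star X) (star Y))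
    (hX : X ∈ StarAlgebra.adjoin ℂ s) :
    ∃ Y, AsympIntertwines ρ V X Y ∧ AsympIntertwines ρ V (star X) (star Y) := by
  refine StarAlgebra.adjoin_induction
    (p := fun X _ => ∃ Y, AsympIntertwines ρ V X Y ∧ AsympIntertwines ρ V (star X) (star Y))
    hs (fun r => ?_) (fun x y _ _ hx hy => ?_) (fun x y _ _ hx hy => ?_) (fun x _ hx => ?_) hX
  · rw [Algebra.algebraMap_eq_smul_one]
    exact ⟨_, smul_one r, by simpa only [star_smul, star_one] using smul_one (star r)⟩
  · obtain ⟨a, ha, ha'⟩ := hx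
    obtain ⟨b, hb, hb'⟩ := hy
    exact ⟨a + b, ha.add hb, by simpa only [star_add] using ha'.add hb'⟩
  · obtain ⟨a, ha, ha'⟩ := hx
    obtain ⟨b, hb, hb'⟩ := hy
    exact ⟨a * b, ha.mul hρ hb, by simpa only [star_mul] using hb'.mul hρ ha'⟩
  · obtain ⟨a, ha, ha'⟩ := hx
    exact ⟨star a, ha', by simpa only [star_star] using ha⟩

/-- If every generator of `T` and its adjoint are asymptotically intertwined with an operator and
its adjoint, then the limit defines a star-homomorphism on `T`. -/
theorem exists_starAlgHom (hρ : ∀ n X, ‖ρ n X‖ ≤ ‖X‖) (hV : ∀ n x, ‖V n x‖ = ‖x‖)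
    {s : Set (E →L[ℂ] E)} {T : StarSubalgebra ℂ (E →L[ℂ] E)}
    (hT : T = (StarAlgebra.adjoin ℂ s).topologicalClosure)
    (hs : ∀ X ∈ s, ∃ Y, AsympIntertwines ρ V X Y ∧ AsympIntertwines ρ V (star X) (star Y)) :
    ∃ π : T →⋆ₐ[ℂ] (F →L[ℂ] F), ∀ X : T, AsympIntertwines ρ V (X : E →L[ℂ] E) (π X) := by
  have hall : ∀ X : T,
      ∃ Y, AsympIntertwines ρ V (X : E →L[ℂ] E) Y ∧ AsympIntertwines ρ V (star X) (star Y) := by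
    rintro ⟨X, hX⟩
    have hX' : X ∈ closure (StarAlgebra.adjoin ℂ s : Set (E →L[ℂ] E)) := by
      rw [hT] at hX
      exact hX
    obtain ⟨x, hx, hlim⟩ := mem_closure_iff_seq_limit.1 hX'
    choose y hy hy' using fun m => exists_of_mem_adjoin hρ hs (hx m)
    have hc : CauchySeq y := by
      have := hlim.cauchySeq
      rw [Metric.cauchySeq_iff] at this ⊢
      intro ε hε
      obtain ⟨N, hN⟩ := this ε hε
      refine ⟨N, fun m hm n hn => lt_of_le_of_lt ?_ (hN m hm n hn)⟩
      rw [dist_eq_norm, dist_eq_norm]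
      exact ((hy m).sub hρ (hy n)).norm_le hρ hV
    obtain ⟨Y, hY⟩ := cauchySeq_tendsto_of_complete hc
    exact ⟨Y, of_tendsto hρ hV hlim hY hy,
      of_tendsto hρ hV (continuous_star.continuousAt.tendsto.comp hlim)
        (continuous_star.continuousAt.tendsto.comp hY) hy'⟩
  choose π hπ hπ' using hall
  refine ⟨⟨⟨⟨⟨⟨π, ?_⟩, ?_⟩, ?_, ?_⟩, ?_⟩, ?_⟩, hπ⟩
  · exact unique hρ hV (hπ 1) (by simpa using smul_one (ρ := ρ) (V := V) 1)
  · exact fun x y => unique hρ hV (hπ (x * y)) ((hπ x).mul hρ (hπ y))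
  · exact unique hρ hV (hπ 0) (by simpa using smul_one (ρ := ρ) (V := V) 0)
  · exact fun x y => unique hρ hV (hπ (x + y)) ((hπ x).add (hπ y))
  · intro r
    rw [Algebra.algebraMap_eq_smul_one, Algebra.algebraMap_eq_smul_one]
    exact unique hρ hV (hπ _) (smul_one r)
  · exact fun x => unique hρ hV (hπ (star x)) (hπ' x)

end AsympIntertwines

end AsymptoticIntertwiner

section Fock

variable {d : ℕ}

theorem inner_fockBasis_left (α : FreeMonoid (Fin d)) (x : FockSpace d) :
    inner ℂ (fockBasis d α) x = x α := by
  rw [fockBasis, lp.inner_single_left]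
  simp

theorem fockBasis_apply (α β : FreeMonoid (Fin d)) :
    fockBasis d α β = if β = α then 1 else 0 := by
  rw [fockBasis, lp.single_apply, Pi.single_apply]

theorem fock_ext {F : Type*} [NormedAddCommGroup F] [NormedSpace ℂ F]
    {A B : FockSpace d →L[ℂ] F} (h : ∀ α, A (fockBasis d α) = B (fockBasis d α)) : A = B := by
  refine lp.ext_continuousLinearMap (by simp) fun α => ?_
  ext
  simpa [fockBasis] using h α

theorem fock_op_ext {A B : FockSpace d →L[ℂ] FockSpace d}
    (h : ∀ α β, inner ℂ (fockBasis d α) (A (fockBasis d β)) =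
      inner ℂ (fockBasis d α) (B (fockBasis d β))) : A = B := by
  refine fock_ext fun β => ?_
  ext α
  simpa only [inner_fockBasis_left] using h α β

theorem inner_fockBasis (α β : FreeMonoid (Fin d)) :
    inner ℂ (fockBasis d α) (fockBasis d β) = if α = β then 1 else 0 := by
  rw [inner_fockBasis_left, fockBasis_apply]

section Creation

variable {S : Fin d → (FockSpace d →L[ℂ] FockSpace d)}
  (hS : ∀ (i : Fin d) (α : FreeMonoid (Fin d)),
      S i (fockBasis d α) = fockBasis d (FreeMonoid.of i * α))
include hS

theorem creation_adjoint_mul (i j : Fin d) :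
    adjoint (S i) * S j = if i = j then 1 else 0 := by
  refine fock_op_ext fun α β => ?_
  have hij : FreeMonoid.of i * α = FreeMonoid.of j * β ↔ i = j ∧ α = β :=
    List.cons_eq_cons (a := i) (b := j)
  rw [mul_def, comp_apply, adjoint_inner_right, hS, hS, inner_fockBasis]
  simp only [hij]
  by_cases h : i = j
  · simp only [h, true_and, if_true]
    exact (inner_fockBasis α β).symm
  · simp [h]

theorem creation_adjoint_basis_one (i : Fin d) : adjoint (S i) (fockBasis d 1) = 0 := by
  ext β
  have : ¬ FreeMonoid.of i * β = 1 := fun h => List.cons_ne_nil i (FreeMonoid.toList β) h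
  rw [← inner_fockBasis_left, adjoint_inner_right, hS, inner_fockBasis, if_neg this]
  rfl

variable {P : ℕ → (FockSpace d →L[ℂ] FockSpace d)}
  (hP : ∀ (k : ℕ) (α : FreeMonoid (Fin d)),
      P k (fockBasis d α) = if α.length = k then fockBasis d α else 0)
include hP

theorem one_sub_sum_creation :
    1 - ∑ i, S i * adjoint (S i) = P 0 := by
  refine fock_ext fun α => ?_
  rw [hP]
  induction α using FreeMonoid.casesOn with
  | one => simp [sum_apply, creation_adjoint_basis_one hS]
  | of_mul j β =>
    have h : ∀ i, adjoint (S i) (fockBasis d (FreeMonoid.of j * β)) =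
        if i = j then fockBasis d β else 0 := by
      intro i
      rw [← hS, ← comp_apply, ← mul_def, creation_adjoint_mul hS]
      split_ifs <;> simp
    simp [sum_apply, h, apply_ite, hS]

theorem proj_succ_mul_creation (k : ℕ) (i : Fin d) : P (k + 1) * S i = S i * P k := by
  refine fock_ext fun α => ?_
  have : (FreeMonoid.of i * α).length = k + 1 ↔ α.length = k := by
    simp [FreeMonoid.length_mul, add_comm]
  rw [mul_def, mul_def, comp_apply, comp_apply, hS, hP, hP]
  simp only [this]
  split_ifs <;> simp [hS]

end Creation

theorem finite_length_eq (k : ℕ) : {α : FreeMonoid (Fin d) | α.length = k}.Finite :=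
  List.finite_length_eq (Fin d) k

section Projections

variable {P : ℕ → (FockSpace d →L[ℂ] FockSpace d)}
  (hP : ∀ (k : ℕ) (α : FreeMonoid (Fin d)),
      P k (fockBasis d α) = if α.length = k then fockBasis d α else 0)
include hP

theorem proj_apply (k : ℕ) (x : FockSpace d) (α : FreeMonoid (Fin d)) :
    P k x α = if α.length = k then x α else 0 := by
  have : (innerSL ℂ (fockBasis d α)) ∘L P k =
      if α.length = k then innerSL ℂ (fockBasis d α) else 0 := by
    refine fock_ext fun β => ?_
    rw [comp_apply, innerSL_apply_apply, hP]
    by_cases h : α = β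
    · subst h
      split_ifs <;> simp
    · split_ifs <;> simp [inner_fockBasis, h]
  have h2 := congrArg (fun A => A x) this
  simp only [comp_apply, innerSL_apply_apply, inner_fockBasis_left] at h2
  rw [h2]
  split_ifs <;> simp [inner_fockBasis_left]

theorem proj_mul_proj (k l : ℕ) : P k * P l = if k = l then P k else 0 := by
  refine fock_ext fun α => ?_
  rw [mul_def, comp_apply, hP]
  split_ifs with h1 h2 h2
  · rfl
  · rw [hP, if_neg (by omega)]
    rfl
  · rw [hP, if_neg (by omega), map_zero]
  · simp

theorem proj_adjoint (k : ℕ) : adjoint (P k) = P k := by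
  refine fock_op_ext fun α β => ?_
  rw [adjoint_inner_right, hP, hP]
  by_cases h : α = β
  · subst h
    split_ifs <;> simp
  · split_ifs <;> simp [inner_fockBasis, h]

theorem proj_isCompact (k : ℕ) : IsCompactOperator ⇑(P k) := by
  have hsum : P k = ∑ α ∈ (finite_length_eq k).toFinset,
      (toSpanSingleton ℂ (fockBasis d α)) ∘L innerSL ℂ (fockBasis d α) := by
    refine fock_ext fun β => ?_
    simp [sum_apply, inner_fockBasis, hP]
  rw [hsum]
  refine Submodule.sum_mem (compactOperator (RingHom.id ℂ) (FockSpace d) (FockSpace d))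
    fun α _ => ?_
  exact (isCompactOperator_of_locallyCompactSpace_rng
    (toSpanSingleton ℂ (fockBasis d α))).comp_clm (innerSL ℂ (fockBasis d α))

end Projections

end Fock

section Tail

variable {E : Type*} [NormedAddCommGroup E] [InnerProductSpace ℂ E] [CompleteSpace E]

/-- A sequence of mutually orthogonal compact projections with sum `1`. -/
structure IsGrading (P : ℕ → (E →L[ℂ] E)) : Prop where
  mul_proj : ∀ k l, P k * P l = if k = l then P k else 0
  adj : ∀ k, adjoint (P k) = P k
  compact : ∀ k, IsCompactOperator ⇑(P k)
  tendsto : ∀ x, Tendsto (fun n => ∑ k ∈ Finset.range n, P k x) atTop (𝓝 x)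

/-- The projection onto the components of degree at least `n`. -/
def tailProj (P : ℕ → (E →L[ℂ] E)) (n : ℕ) : E →L[ℂ] E := 1 - ∑ k ∈ Finset.range n, P k

omit [CompleteSpace E] in
theorem commute_tailProj {P : ℕ → (E →L[ℂ] E)} {A : E →L[ℂ] E} (hA : ∀ k, A * P k = P k * A)
    (n : ℕ) :
    A * tailProj P n = tailProj P n * A := by
  simp only [tailProj, mul_sub, sub_mul, Finset.mul_sum, Finset.sum_mul, hA, one_mul, mul_one]

theorem isUnit_of_commute_star_of_le {B : E →L[ℂ] E} (hB : Commute (adjoint B) B) {c : ℝ}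
    (hc : 0 < c) (h : ∀ x, c * ‖x‖ ^ 2 ≤ ‖B x‖ ^ 2) : IsUnit B := by
  have : IsUnit (adjoint B * B) := by
    refine isUnit_of_forall_le_norm_inner_map _ (c := ⟨c, hc.le⟩) hc fun x => ?_
    rw [mul_def, comp_apply, adjoint_inner_left, inner_self_eq_norm_sq_to_K, mul_comm]
    refine (h x).trans_eq ?_
    simp
  exact (hB.isUnit_mul_iff.1 this).2

namespace IsGrading

variable {P : ℕ → (E →L[ℂ] E)} (hP : IsGrading P)
include hP

theorem tailProj_mul_proj {n m : ℕ} (h : n ≤ m) : tailProj P n * P m = P m := by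
  rw [tailProj, sub_mul, Finset.sum_mul, Finset.sum_eq_zero, one_mul, sub_zero]
  intro k hk
  rw [hP.mul_proj, if_neg]
  have := Finset.mem_range.1 hk
  omega

theorem proj_mul_tailProj {n m : ℕ} (h : m < n) : P m * tailProj P n = 0 := by
  rw [tailProj, mul_sub, Finset.mul_sum, mul_one, sub_eq_zero]
  simp only [hP.mul_proj]
  rw [Finset.sum_ite_eq, if_pos (Finset.mem_range.2 h)]

theorem tailProj_adjoint (n : ℕ) : adjoint (tailProj P n) = tailProj P n := by
  rw [tailProj, map_sub, map_sum, ← star_eq_adjoint, star_one]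
  simp only [hP.adj]

theorem tailProj_mul_tailProj {m n : ℕ} (h : m ≤ n) :
    tailProj P m * tailProj P n = tailProj P n := by
  conv_lhs => rw [tailProj, sub_mul, Finset.sum_mul, one_mul]
  rw [Finset.sum_eq_zero, sub_zero]
  intro k hk
  exact hP.proj_mul_tailProj (lt_of_lt_of_le (Finset.mem_range.1 hk) h)

theorem inner_tailProj (n : ℕ) (x : E) : inner ℂ (tailProj P n x) (x - tailProj P n x) = 0 := by
  conv_lhs => rw [← hP.tailProj_adjoint, adjoint_inner_left, map_sub, ← comp_apply, ← mul_def,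
    hP.tailProj_adjoint, hP.tailProj_mul_tailProj le_rfl, sub_self, inner_zero_right]

theorem norm_sq_eq (n : ℕ) (x : E) :
    ‖x‖ ^ 2 = ‖tailProj P n x‖ ^ 2 + ‖x - tailProj P n x‖ ^ 2 := by
  have := norm_add_sq_eq_norm_sq_add_norm_sq_of_inner_eq_zero _ _ (hP.inner_tailProj n x)
  rw [add_sub_cancel] at this
  simpa only [sq] using this

theorem norm_tailProj_le (n : ℕ) : ‖tailProj P n‖ ≤ 1 := by
  refine opNorm_le_bound _ zero_le_one fun x => ?_
  rw [one_mul]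
  refine le_of_sq_le_sq ?_ (norm_nonneg x)
  rw [hP.norm_sq_eq n x]
  exact le_add_of_nonneg_right (sq_nonneg _)

theorem tendsto_tailProj (x : E) : Tendsto (fun n => tailProj P n x) atTop (𝓝 0) := by
  simpa [tailProj, sum_apply] using (hP.tendsto x).const_sub x

theorem isCompact_one_sub_tailProj (n : ℕ) : IsCompactOperator ⇑(1 - tailProj P n) := by
  rw [tailProj, sub_sub_cancel]
  exact Submodule.sum_mem (compactOperator (RingHom.id ℂ) E E) fun k _ => hP.compact k

theorem tendsto_tailProj_mul {L : E →L[ℂ] E} (hL : IsCompactOperator ⇑L) :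
    Tendsto (fun n => ‖tailProj P n * L‖) atTop (𝓝 0) := by
  rw [Metric.tendsto_atTop]
  intro ε hε
  have hc := (hL.isCompact_closure_image_closedBall 1).totallyBounded
  obtain ⟨t, ht, hcov⟩ := Metric.totallyBounded_iff.1 hc (ε / 4) (by positivity)
  have hev : ∀ᶠ n in atTop, ∀ y ∈ t, ‖tailProj P n y‖ < ε / 4 := by
    rw [Filter.eventually_all_finite ht]
    intro y _
    simpa using Metric.tendsto_nhds.1 (hP.tendsto_tailProj y) (ε / 4) (by positivity)
  obtain ⟨N, hN⟩ := eventually_atTop.1 hev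
  refine ⟨N, fun n hn => ?_⟩
  rw [Real.dist_eq, sub_zero, abs_norm]
  refine lt_of_le_of_lt (opNorm_le_of_unit_norm (C := ε / 2) (by positivity) fun x hx => ?_)
    (by linarith)
  have hmem : L x ∈ closure (L '' Metric.closedBall 0 1) :=
    subset_closure ⟨x, by simp [hx], rfl⟩
  obtain ⟨y, hy, hxy⟩ := Set.mem_iUnion₂.1 (hcov hmem)
  rw [Metric.mem_ball, dist_eq_norm] at hxy
  have h1 : tailProj P n (L x) = tailProj P n (L x - y) + tailProj P n y := by simp
  have h2 := le_of_opNorm_le _ (hP.norm_tailProj_le n) (L x - y)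
  rw [mul_def, comp_apply, h1]
  linarith [norm_add_le (tailProj P n (L x - y)) (tailProj P n y), hN n hn y hy]

theorem tendsto_mul_tailProj_of_adjoint_mul {L : E →L[ℂ] E}
    (hL : IsCompactOperator ⇑(adjoint L * L)) :
    Tendsto (fun n => ‖L * tailProj P n‖) atTop (𝓝 0) := by
  have h := (hP.tendsto_tailProj_mul hL).sqrt
  rw [Real.sqrt_zero] at h
  refine squeeze_zero (fun _ => norm_nonneg _) (fun n => Real.le_sqrt_of_sq_le ?_) h
  calc ‖L * tailProj P n‖ ^ 2 = ‖star (L * tailProj P n) * (L * tailProj P n)‖ := by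
        rw [CStarRing.norm_star_mul_self, sq]
    _ = ‖(tailProj P n * (adjoint L * L)) * tailProj P n‖ := by
        rw [star_mul, star_eq_adjoint, star_eq_adjoint, hP.tailProj_adjoint]
        simp only [mul_assoc]
    _ ≤ ‖tailProj P n * (adjoint L * L)‖ * 1 :=
        (norm_mul_le _ _).trans (mul_le_mul_of_nonneg_left (hP.norm_tailProj_le n) (norm_nonneg _))
    _ = _ := mul_one _

theorem tendsto_mul_tailProj {L : E →L[ℂ] E} (hL : IsCompactOperator ⇑L) :
    Tendsto (fun n => ‖L * tailProj P n‖) atTop (𝓝 0) :=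
  hP.tendsto_mul_tailProj_of_adjoint_mul (hL.clm_comp (adjoint L))

theorem norm_sum_proj_sq (x : E) (n : ℕ) :
    ‖∑ k ∈ Finset.range n, P k x‖ ^ 2 = ∑ k ∈ Finset.range n, ‖P k x‖ ^ 2 := by
  induction n with
  | zero => simp
  | succ n ih =>
    have h0 : inner ℂ (∑ k ∈ Finset.range n, P k x) (P n x) = 0 := by
      rw [sum_inner]
      refine Finset.sum_eq_zero fun k hk => ?_
      rw [← hP.adj k, adjoint_inner_left, ← comp_apply, ← mul_def, hP.mul_proj, if_neg]
      · simp
      · exact (Finset.mem_range.1 hk).ne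
    have := norm_add_sq_eq_norm_sq_add_norm_sq_of_inner_eq_zero _ _ h0
    rw [Finset.sum_range_succ, Finset.sum_range_succ, ← ih]
    simpa only [sq] using this

theorem norm_le_of_forall_proj {A : E →L[ℂ] E} (hA : ∀ k, A * P k = P k * A) {n : ℕ} {ε : ℝ}
    (hε : 0 ≤ ε) (h : ∀ k, n ≤ k → ∀ x, P k x = x → ε * ‖x‖ ≤ ‖A x‖) (x : E) :
    ε * ‖tailProj P n x‖ ≤ ‖A (tailProj P n x)‖ := by
  set y := tailProj P n x with hy
  have hA' : ∀ k z, A (P k z) = P k (A z) := fun k z => congrArg (fun B => B z) (hA k)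
  have hlow : ∀ k, ε * ‖P k y‖ ≤ ‖P k (A y)‖ := by
    intro k
    rcases lt_or_ge k n with hk | hk
    · rw [hy, ← comp_apply (P k), ← mul_def, hP.proj_mul_tailProj hk]
      simp
    · rw [← hA']
      refine h k hk _ ?_
      rw [← comp_apply (P k), ← mul_def, hP.mul_proj, if_pos rfl]
  refine le_of_tendsto_of_tendsto' (((hP.tendsto y).norm).const_mul ε) ((hP.tendsto (A y)).norm)
    fun m => ?_
  refine le_of_sq_le_sq ?_ (norm_nonneg _)
  rw [mul_pow, hP.norm_sum_proj_sq, hP.norm_sum_proj_sq, Finset.mul_sum]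
  refine Finset.sum_le_sum fun k _ => ?_
  rw [← mul_pow]
  exact pow_le_pow_left₀ (by positivity) (hlow k) 2

/-- A self-adjoint operator that respects the grading and is bounded below in high degrees is
invertible modulo compact operators. -/
theorem exists_inverse_mod_compact {A : E →L[ℂ] E} (hsa : adjoint A = A)
    (hA : ∀ k, A * P k = P k * A) {n : ℕ} {ε : ℝ} (hε : 0 < ε)
    (h : ∀ k, n ≤ k → ∀ x, P k x = x → ε * ‖x‖ ≤ ‖A x‖) :
    ∃ V : E →L[ℂ] E, IsCompactOperator ⇑(A * V - 1) ∧ IsCompactOperator ⇑(V * A - 1) := by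
  set Q := tailProj P n with hQ
  have hAQ : A * Q = Q * A := commute_tailProj hA n
  have hQQ : Q * Q = Q := hP.tailProj_mul_tailProj le_rfl
  set B := A * Q + (1 - Q) with hB
  have hBsa : adjoint B = B := by
    have h1 : star (A * Q) = A * Q := by
      rw [star_mul, star_eq_adjoint, star_eq_adjoint, hsa, hP.tailProj_adjoint, hAQ]
    rw [← star_eq_adjoint, hB, star_add, h1, star_sub, star_one, star_eq_adjoint,
      hP.tailProj_adjoint]
  have hQB : Q * B = A * Q := by
    rw [hB, mul_add, ← mul_assoc, ← hAQ, mul_assoc, hQQ, mul_sub, mul_one, hQQ, sub_self, add_zero]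
  have hunit : IsUnit B := by
    refine isUnit_of_commute_star_of_le (by rw [hBsa]) (c := min (ε ^ 2) 1) (by positivity)
      fun x => ?_
    have e1 : tailProj P n (B x) = A (tailProj P n x) := congrArg (fun C => C x) hQB
    have e2 : B x - tailProj P n (B x) = x - tailProj P n x := by
      rw [e1]
      simp [hB, hQ]
    rw [hP.norm_sq_eq n (B x), e2, e1, hP.norm_sq_eq n x, mul_add]
    have h3 := pow_le_pow_left₀ (by positivity) (hP.norm_le_of_forall_proj hA hε.le h x) 2
    rw [mul_pow] at h3
    refine add_le_add (le_trans ?_ h3) ?_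
    · exact mul_le_mul_of_nonneg_right (min_le_left _ _) (sq_nonneg _)
    · exact mul_le_of_le_one_left (sq_nonneg _) (min_le_right _ _)
  obtain ⟨u, hu⟩ := hunit
  have hAB : A - B = (A - 1) * (1 - Q) := by
    rw [hB]
    noncomm_ring
  have hc : IsCompactOperator ⇑(A - B) := by
    rw [hAB]
    exact (hP.isCompact_one_sub_tailProj n).clm_comp (A - 1)
  refine ⟨↑u⁻¹, ?_, ?_⟩
  · have : A * ↑u⁻¹ - 1 = (A - B) * ↑u⁻¹ := by rw [sub_mul, ← hu, Units.mul_inv]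
    rw [this]
    exact hc.comp_clm (↑u⁻¹ : E →L[ℂ] E)
  · have : ↑u⁻¹ * A - 1 = ↑u⁻¹ * (A - B) := by rw [mul_sub, ← hu, Units.inv_mul]
    rw [this]
    exact hc.clm_comp (↑u⁻¹ : E →L[ℂ] E)

end IsGrading

end Tail

theorem isGrading_of_fockBasis {d : ℕ} {P : ℕ → (FockSpace d →L[ℂ] FockSpace d)}
    (hP : ∀ (k : ℕ) (α : FreeMonoid (Fin d)),
      P k (fockBasis d α) = if α.length = k then fockBasis d α else 0) : IsGrading P where
  mul_proj := proj_mul_proj hP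
  adj := proj_adjoint hP
  compact := proj_isCompact hP
  tendsto x := by
    have hfin : ∀ n, {α : FreeMonoid (Fin d) | α.length < n}.Finite := fun n =>
      List.finite_length_lt (Fin d) n
    have hsum : ∀ n, ∑ k ∈ Finset.range n, P k x =
        ∑ α ∈ (hfin n).toFinset, (lp.single 2 α (x α) : FockSpace d) := by
      intro n
      ext β
      rw [lp.coeFn_sum, lp.coeFn_sum, Finset.sum_apply, Finset.sum_apply]
      simp only [proj_apply hP, lp.single_apply, Pi.single_apply]
      simp
    simp only [hsum]
    refine (lp.hasSum_single (by simp) x).comp (tendsto_atTop_finset_of_monotone ?_ ?_)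
    · intro m n hmn
      simp only [Set.Finite.toFinset_subset_toFinset]
      exact fun α (hα : α.length < m) => hα.trans_le hmn
    · exact fun α => ⟨α.length + 1, by simp⟩

theorem IsGrading.exists_approx_eigenvector {E : Type*} [NormedAddCommGroup E]
    [InnerProductSpace ℂ E] [CompleteSpace E] {P : ℕ → (E →L[ℂ] E)} (hP : IsGrading P)
    {Z : E →L[ℂ] E} (hZ : adjoint Z = Z) (hZP : ∀ k, Z * P k = P k * Z) {r : ℝ}
    (hr : ¬ ∃ V : E →L[ℂ] E, IsCompactOperator ⇑((Z - (r : ℂ) • 1) * V - 1) ∧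
      IsCompactOperator ⇑(V * (Z - (r : ℂ) • 1) - 1)) (n : ℕ) {ε : ℝ} (hε : 0 < ε) :
    ∃ k x, n ≤ k ∧ P k x = x ∧ ‖x‖ = 1 ∧ ‖Z x - (r : ℂ) • x‖ ≤ ε := by
  by_contra! hcon
  refine hr (hP.exists_inverse_mod_compact (n := n) (ε := ε) ?_ ?_ hε ?_)
  · rw [← star_eq_adjoint, star_sub, star_smul, star_one, star_eq_adjoint, hZ]
    simp
  · intro k
    rw [sub_mul, mul_sub, hZP k]
    simp
  · intro k hk x hx
    rcases eq_or_ne x 0 with rfl | h0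
    · simp
    have hn : (0 : ℝ) < ‖x‖ := norm_pos_iff.2 h0
    have := hcon k (((‖x‖⁻¹ : ℝ) : ℂ) • x) hk (by rw [map_smul, hx]) (by
      rw [norm_smul, Complex.norm_real, norm_inv, norm_norm, inv_mul_cancel₀ hn.ne'])
    rw [map_smul, smul_comm, ← smul_sub, norm_smul, Complex.norm_real, norm_inv, norm_norm,
      lt_inv_mul_iff₀ hn] at this
    rw [mul_comm]
    simpa using this.le

section Ampliation

variable {E : Type*} [NormedAddCommGroup E] [InnerProductSpace ℂ E]

/-- The diagonal action of an operator on a direct sum of copies of the space. -/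
def ampliation (C : Type*) :
    (E →L[ℂ] E) →ₐ[ℂ] (lp (fun _ : C => E) 2 →L[ℂ] lp (fun _ : C => E) 2) :=
  AlgHom.ofLinearMap
    { toFun := fun X => lp.mapCLM 2 (fun _ : C => X) (norm_nonneg X) (fun _ => le_rfl)
      map_add' := fun X Y => by ext; simp
      map_smul' := fun c X => by ext; simp }
    (by ext; simp) (fun X Y => by ext; simp)

variable {C : Type*}

@[simp]
theorem ampliation_apply (X : E →L[ℂ] E) (f : lp (fun _ : C => E) 2) (c : C) :
    ampliation C X f c = X (f c) := rfl

theorem norm_ampliation_le (X : E →L[ℂ] E) : ‖ampliation C X‖ ≤ ‖X‖ :=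
  lp.norm_mapCLM_le 2 (fun _ : C => X) (norm_nonneg X) (fun _ => le_rfl)

theorem inner_ampliation_left [CompleteSpace E] (X : E →L[ℂ] E) (f g : lp (fun _ : C => E) 2) :
    inner ℂ (ampliation C X f) g = inner ℂ f (ampliation C (adjoint X) g) := by
  rw [lp.inner_eq_tsum, lp.inner_eq_tsum]
  simp only [ampliation_apply, adjoint_inner_right]

end Ampliation

section Layers

variable {E F : Type*} [NormedAddCommGroup E] [InnerProductSpace ℂ E] [CompleteSpace E]
  [NormedAddCommGroup F] [InnerProductSpace ℂ F] [CompleteSpace F] {C : Type*} {d : ℕ}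

/-- `∑ S_α V₀ U_α*`, summed over all words `α` of length `k`. -/
def layer (S : Fin d → (E →L[ℂ] E)) (U : Fin d → (F →L[ℂ] F))
    (V₀ : F →L[ℂ] lp (fun _ : C => E) 2) : ℕ → (F →L[ℂ] lp (fun _ : C => E) 2)
  | 0 => V₀
  | k + 1 => ∑ i, ampliation C (S i) ∘L layer S U V₀ k ∘L adjoint (U i)

variable {S : Fin d → (E →L[ℂ] E)} {U : Fin d → (F →L[ℂ] F)}
  {V₀ : F →L[ℂ] lp (fun _ : C => E) 2}

omit [CompleteSpace E] in
theorem layer_succ_apply (k : ℕ) (h : F) : layer S U V₀ (k + 1) h =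
    ∑ i, ampliation C (S i) (layer S U V₀ k (adjoint (U i) h)) := by
  simp [layer, sum_apply]

omit [CompleteSpace E] in
theorem layer_succ_comp (hU : ∀ i j, adjoint (U i) * U j = if i = j then 1 else 0) (k : ℕ)
    (i : Fin d) (h : F) :
    layer S U V₀ (k + 1) (U i h) = ampliation C (S i) (layer S U V₀ k h) := by
  have h1 : ∀ j, adjoint (U j) (U i h) = if j = i then h else 0 := by
    intro j
    rw [← comp_apply, ← mul_def, hU]
    split_ifs <;> simp
  rw [layer_succ_apply]
  simp only [h1]
  rw [Finset.sum_eq_single i (fun j _ hj => by simp [hj]) (by simp), if_pos rfl]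

variable (hS : ∀ i j, adjoint (S i) * S j = if i = j then 1 else 0)
include hS

theorem ampliation_adjoint_creation (i j : Fin d) (f : lp (fun _ : C => E) 2) :
    ampliation C (adjoint (S i)) (ampliation C (S j) f) = if i = j then f else 0 := by
  rw [← comp_apply, ← mul_def, ← map_mul, hS]
  split_ifs <;> simp

theorem ampliation_adjoint_layer_succ (k : ℕ) (i : Fin d) (h : F) :
    ampliation C (adjoint (S i)) (layer S U V₀ (k + 1) h) =
      layer S U V₀ k (adjoint (U i) h) := by
  rw [layer_succ_apply, map_sum]
  simp only [ampliation_adjoint_creation hS]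
  simp

theorem norm_ampliation_creation (i : Fin d) (f : lp (fun _ : C => E) 2) :
    ‖ampliation C (S i) f‖ = ‖f‖ := by
  rw [@norm_eq_sqrt_re_inner ℂ, @norm_eq_sqrt_re_inner ℂ _ _ _ _ f, inner_ampliation_left,
    ampliation_adjoint_creation hS, if_pos rfl]

theorem inner_layer (hUsum : ∑ i, U i * adjoint (U i) = 1)
    (hV₀ : ∀ g h, inner ℂ (V₀ g) (V₀ h) = inner ℂ g h) (k : ℕ) (g h : F) :
    inner ℂ (layer S U V₀ k g) (layer S U V₀ k h) = inner ℂ g h := by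
  induction k generalizing g h with
  | zero => exact hV₀ g h
  | succ k ih =>
    rw [layer_succ_apply k g, sum_inner]
    simp only [inner_ampliation_left, ampliation_adjoint_layer_succ hS, ih]
    calc ∑ i, inner ℂ (adjoint (U i) g) (adjoint (U i) h)
        = inner ℂ g ((∑ i, U i * adjoint (U i)) h) := by
          simp only [adjoint_inner_left, sum_apply, inner_sum, mul_def, comp_apply]
      _ = inner ℂ g h := by rw [hUsum, one_apply_eq_self]

end Layers

section LayerSums

variable {E F : Type*} [NormedAddCommGroup E] [InnerProductSpace ℂ E] [CompleteSpace E]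
  [NormedAddCommGroup F] [InnerProductSpace ℂ F] [CompleteSpace F] {C : Type*} {d : ℕ}
  {S : Fin d → (E →L[ℂ] E)} {U : Fin d → (F →L[ℂ] F)} {V₀ : F →L[ℂ] lp (fun _ : C => E) 2}

theorem norm_layer (hS : ∀ i j, adjoint (S i) * S j = if i = j then 1 else 0)
    (hUsum : ∑ i, U i * adjoint (U i) = 1)
    (hV₀ : ∀ g h, inner ℂ (V₀ g) (V₀ h) = inner ℂ g h) (k : ℕ) (h : F) :
    ‖layer S U V₀ k h‖ = ‖h‖ := by
  rw [@norm_eq_sqrt_re_inner ℂ, inner_layer hS hUsum hV₀, ← @norm_eq_sqrt_re_inner ℂ]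

theorem norm_adjoint_apply_le (hUsum : ∑ i, U i * adjoint (U i) = 1) (i : Fin d) (h : F) :
    ‖adjoint (U i) h‖ ≤ ‖h‖ := by
  have h1 : ∑ j, ‖adjoint (U j) h‖ ^ 2 = ‖h‖ ^ 2 := by
    have h2 : ∑ j, inner ℂ (adjoint (U j) h) (adjoint (U j) h) = inner ℂ h h := by
      calc ∑ j, inner ℂ (adjoint (U j) h) (adjoint (U j) h)
          = inner ℂ h ((∑ j, U j * adjoint (U j)) h) := by
            simp only [adjoint_inner_left, sum_apply, inner_sum, mul_def, comp_apply]
        _ = inner ℂ h h := by rw [hUsum, one_apply_eq_self]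
    simp only [inner_self_eq_norm_sq_to_K] at h2
    exact_mod_cast h2
  refine le_of_sq_le_sq ?_ (norm_nonneg h)
  rw [← h1]
  exact Finset.single_le_sum (f := fun j => ‖adjoint (U j) h‖ ^ 2) (fun j _ => sq_nonneg _)
    (Finset.mem_univ i)

variable {P : ℕ → (E →L[ℂ] E)} {deg : C → ℕ}

omit [CompleteSpace E] in
theorem proj_layer (hPS : ∀ m i, P (m + 1) * S i = S i * P m)
    (hdeg : ∀ h c, P (deg c) (V₀ h c) = V₀ h c) (k : ℕ) (h : F) (c : C) :
    P (deg c + k) (layer S U V₀ k h c) = layer S U V₀ k h c := by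
  induction k generalizing h with
  | zero => exact hdeg h c
  | succ k ih =>
    rw [layer_succ_apply, lp.coeFn_sum, Finset.sum_apply, map_sum]
    refine Finset.sum_congr rfl fun i _ => ?_
    rw [ampliation_apply, ← add_assoc, ← comp_apply (P _), ← mul_def, hPS, mul_def, comp_apply, ih]

theorem inner_layer_of_ne (hP : IsGrading P) (hPS : ∀ m i, P (m + 1) * S i = S i * P m)
    (hdeg : ∀ h c, P (deg c) (V₀ h c) = V₀ h c) {k l : ℕ} (hkl : k ≠ l) (g h : F) :
    inner ℂ (layer S U V₀ k g) (layer S U V₀ l h) = 0 := by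
  rw [lp.inner_eq_tsum]
  refine (tsum_congr fun c => ?_).trans tsum_zero
  rw [← proj_layer hPS hdeg k g c, ← proj_layer hPS hdeg l h c, ← hP.adj, adjoint_inner_left,
    ← comp_apply, ← mul_def, hP.mul_proj, if_neg (by omega), zero_apply, inner_zero_right]

theorem ampliation_tailProj_layer (hP : IsGrading P)
    (hPS : ∀ m i, P (m + 1) * S i = S i * P m)
    (hdeg : ∀ h c, P (deg c) (V₀ h c) = V₀ h c) {n : ℕ} (hn : ∀ c, n ≤ deg c) (k : ℕ) (h : F) :
    ampliation C (tailProj P n) (layer S U V₀ k h) = layer S U V₀ k h := by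
  ext c
  rw [ampliation_apply, ← proj_layer hPS hdeg k h c, ← comp_apply, ← mul_def,
    hP.tailProj_mul_proj ((hn c).trans (Nat.le_add_right _ _))]

omit [CompleteSpace E] in
theorem norm_ampliation_apply_le {n : ℕ} {v : lp (fun _ : C => E) 2}
    (hv : ampliation C (tailProj P n) v = v) (L : E →L[ℂ] E) :
    ‖ampliation C L v‖ ≤ ‖L * tailProj P n‖ * ‖v‖ := by
  conv_lhs => rw [← hv, ← comp_apply, ← mul_def, ← map_mul]
  exact le_of_opNorm_le _ (norm_ampliation_le _) _

theorem norm_ampliation_layer_sub_le (hS : ∀ i j, adjoint (S i) * S j = if i = j then 1 else 0)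
    (hUsum : ∑ i, U i * adjoint (U i) = 1)
    (hV₀ : ∀ g h, inner ℂ (V₀ g) (V₀ h) = inner ℂ g h)
    (hP : IsGrading P) (hPS : ∀ m i, P (m + 1) * S i = S i * P m)
    (hdeg : ∀ h c, P (deg c) (V₀ h c) = V₀ h c) {n : ℕ} (hn : ∀ c, n ≤ deg c)
    {Z : E →L[ℂ] E} {R : F →L[ℂ] F} (hUR : ∀ i, adjoint (U i) * R = R * adjoint (U i)) {δ : ℝ}
    (hδ : 0 ≤ δ) (hZ : ∀ i, ‖(S i * Z - Z * S i) * tailProj P n‖ ≤ δ)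
    (hR : ∀ h, ‖ampliation C Z (V₀ h) - V₀ (R h)‖ ≤ δ * ‖h‖) (k : ℕ) (h : F) :
    ‖ampliation C Z (layer S U V₀ k h) - layer S U V₀ k (R h)‖ ≤ (2 * d + 2) ^ k * δ * ‖h‖ := by
  induction k generalizing h with
  | zero => simpa [layer] using hR h
  | succ k ih =>
    set a := layer S U V₀ k
    have hterm : ∀ i, ampliation C Z (ampliation C (S i) (a (adjoint (U i) h))) -
        ampliation C (S i) (a (adjoint (U i) (R h))) =
        ampliation C (S i) (ampliation C Z (a (adjoint (U i) h)) - a (R (adjoint (U i) h))) -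
          ampliation C (S i * Z - Z * S i) (a (adjoint (U i) h)) := by
      intro i
      rw [← comp_apply _ R, ← mul_def, hUR, mul_def, comp_apply, map_sub, map_sub, map_mul,
        map_mul, sub_apply, mul_def, mul_def, comp_apply, comp_apply]
      abel
    have hb : ∀ i, ‖ampliation C Z (ampliation C (S i) (a (adjoint (U i) h))) -
        ampliation C (S i) (a (adjoint (U i) (R h)))‖ ≤ 2 * (2 * d + 2) ^ k * δ * ‖h‖ := by
      intro i
      rw [hterm]
      refine (norm_sub_le _ _).trans ?_
      rw [norm_ampliation_creation hS]
      have h1 := norm_ampliation_apply_le (L := S i * Z - Z * S i)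
        (ampliation_tailProj_layer (U := U) hP hPS hdeg hn k (adjoint (U i) h))
      rw [norm_layer hS hUsum hV₀] at h1
      have h2 := norm_adjoint_apply_le hUsum i h
      have h3 : (1 : ℝ) ≤ (2 * d + 2) ^ k := one_le_pow₀ (by linarith [d.cast_nonneg (α := ℝ)])
      calc _ ≤ (2 * d + 2) ^ k * δ * ‖adjoint (U i) h‖ + δ * ‖adjoint (U i) h‖ :=
            add_le_add (ih _) (h1.trans (by gcongr; exact hZ i))
        _ ≤ (2 * d + 2) ^ k * δ * ‖h‖ + (2 * d + 2) ^ k * δ * ‖h‖ := by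
            gcongr
            exact le_mul_of_one_le_left hδ h3
        _ = _ := by ring
    rw [layer_succ_apply, layer_succ_apply, map_sum, ← Finset.sum_sub_distrib]
    refine (norm_sum_le_of_le _ fun i _ => hb i).trans ?_
    rw [Finset.sum_const, Finset.card_univ, Fintype.card_fin, nsmul_eq_mul, pow_succ]
    have : 0 ≤ (2 * d + 2 : ℝ) ^ k * δ * ‖h‖ := by positivity
    nlinarith

theorem norm_sum_layer (hS : ∀ i j, adjoint (S i) * S j = if i = j then 1 else 0)
    (hUsum : ∑ i, U i * adjoint (U i) = 1)
    (hV₀ : ∀ g h, inner ℂ (V₀ g) (V₀ h) = inner ℂ g h)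
    (hP : IsGrading P) (hPS : ∀ m i, P (m + 1) * S i = S i * P m)
    (hdeg : ∀ h c, P (deg c) (V₀ h c) = V₀ h c) (N : ℕ) (h : F) :
    ‖∑ k ∈ Finset.range N, layer S U V₀ k h‖ = √N * ‖h‖ := by
  rw [← abs_of_nonneg (norm_nonneg (∑ k ∈ Finset.range N, layer S U V₀ k h)),
    ← Real.sqrt_sq (norm_nonneg h), ← Real.sqrt_mul N.cast_nonneg, ← Real.sqrt_sq_eq_abs]
  congr 1
  induction N with
  | zero => simp
  | succ N ih =>
    have h0 : inner ℂ (∑ k ∈ Finset.range N, layer S U V₀ k h) (layer S U V₀ N h) = 0 := by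
      rw [sum_inner]
      exact Finset.sum_eq_zero fun k hk =>
        inner_layer_of_ne hP hPS hdeg (Finset.mem_range.1 hk).ne h h
    have := norm_add_sq_eq_norm_sq_add_norm_sq_of_inner_eq_zero _ _ h0
    rw [← sq, ← sq, ← sq, ih, norm_layer hS hUsum hV₀] at this
    rw [Finset.sum_range_succ, this]
    push_cast
    ring

/-- The layers can be averaged to an isometry that almost intertwines `S` with `U` and, if the
bottom layer almost intertwines `Z` with `R`, also `Z` with `R`. -/
theorem exists_isometry_of_layer (hS : ∀ i j, adjoint (S i) * S j = if i = j then 1 else 0)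
    (hU : ∀ i j, adjoint (U i) * U j = if i = j then 1 else 0)
    (hUsum : ∑ i, U i * adjoint (U i) = 1)
    (hV₀ : ∀ g h, inner ℂ (V₀ g) (V₀ h) = inner ℂ g h)
    (hP : IsGrading P) (hPS : ∀ m i, P (m + 1) * S i = S i * P m)
    (hdeg : ∀ h c, P (deg c) (V₀ h c) = V₀ h c) {n : ℕ} (hn : ∀ c, n ≤ deg c)
    {Z : E →L[ℂ] E} {R : F →L[ℂ] F} (hUR : ∀ i, adjoint (U i) * R = R * adjoint (U i)) {δ : ℝ}
    (hδ : 0 ≤ δ) (hZ : ∀ i, ‖(S i * Z - Z * S i) * tailProj P n‖ ≤ δ)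
    (hR : ∀ h, ‖ampliation C Z (V₀ h) - V₀ (R h)‖ ≤ δ * ‖h‖) {N : ℕ} (hN : 0 < N) :
    ∃ W : F →L[ℂ] lp (fun _ : C => E) 2, (∀ h, ‖W h‖ = ‖h‖) ∧
      (∀ i, ‖ampliation C (S i) ∘L W - W ∘L U i‖ ≤ 2 / √N) ∧
      (∀ i, ‖ampliation C (adjoint (S i)) ∘L W - W ∘L adjoint (U i)‖ ≤ 2 / √N) ∧
      ‖ampliation C Z ∘L W - W ∘L R‖ ≤ N * (2 * d + 2) ^ N * δ ∧
      ∀ L : E →L[ℂ] E, ‖ampliation C L ∘L W‖ ≤ ‖L * tailProj P n‖ := by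
  have hN1 : (1 : ℝ) ≤ N := by exact_mod_cast hN
  have hs : 0 < √(N : ℝ) := Real.sqrt_pos.2 (by positivity)
  have hs1 : (√(N : ℝ))⁻¹ ≤ 1 := inv_le_one_of_one_le₀ (Real.one_le_sqrt.2 hN1)
  have hnU : ∀ i h, ‖U i h‖ = ‖h‖ := by
    intro i h
    rw [@norm_eq_sqrt_re_inner ℂ, @norm_eq_sqrt_re_inner ℂ _ _ _ _ h, ← adjoint_inner_left,
      ← comp_apply, ← mul_def, hU, if_pos rfl, one_apply_eq_self]
  set W : F →L[ℂ] lp (fun _ : C => E) 2 :=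
    (((√(N : ℝ))⁻¹ : ℝ) : ℂ) • ∑ k ∈ Finset.range N, layer S U V₀ k with hW
  have hWh : ∀ h, W h = (((√(N : ℝ))⁻¹ : ℝ) : ℂ) • ∑ k ∈ Finset.range N, layer S U V₀ k h := by
    intro h
    rw [hW, smul_apply, sum_apply]
  have hnorm : ∀ h, ‖W h‖ = ‖h‖ := by
    intro h
    rw [hWh, norm_smul, Complex.norm_real, Real.norm_of_nonneg (by positivity),
      norm_sum_layer hS hUsum hV₀ hP hPS hdeg, inv_mul_cancel_left₀ hs.ne']
  have hbound : ∀ (X : E →L[ℂ] E) (Y : F →L[ℂ] F) (c : ℝ), 0 ≤ c →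
      (∀ h, ‖∑ k ∈ Finset.range N, (ampliation C X (layer S U V₀ k h) - layer S U V₀ k (Y h))‖
        ≤ c * ‖h‖) → ‖ampliation C X ∘L W - W ∘L Y‖ ≤ c / √N := by
    intro X Y c hc h
    refine opNorm_le_bound _ (by positivity) fun x => ?_
    rw [sub_apply, comp_apply, comp_apply, hWh, hWh, map_smul, map_sum, ← smul_sub,
      ← Finset.sum_sub_distrib, norm_smul, Complex.norm_real, Real.norm_of_nonneg (by positivity),
      div_eq_inv_mul, mul_assoc]
    exact mul_le_mul_of_nonneg_left (h x) (by positivity)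
  refine ⟨W, hnorm, fun i => hbound _ _ 2 zero_le_two fun h => ?_,
    fun i => hbound _ _ 2 zero_le_two fun h => ?_, ?_, fun L => ?_⟩
  · simp only [← layer_succ_comp hU]
    rw [Finset.sum_range_sub (fun k => layer S U V₀ k (U i h))]
    refine (norm_sub_le _ _).trans_eq ?_
    rw [norm_layer hS hUsum hV₀, norm_layer hS hUsum hV₀, hnU]
    ring
  · simp only [← ampliation_adjoint_layer_succ (V₀ := V₀) hS]
    rw [Finset.sum_range_sub' (fun k => ampliation C (adjoint (S i)) (layer S U V₀ k h))]
    have h1 : ∀ v : lp (fun _ : C => E) 2, ‖ampliation C (adjoint (S i)) v‖ ≤ ‖v‖ := by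
      intro v
      have hSi : ‖adjoint (S i)‖ ≤ 1 := by
        have h2 : ‖star (S i) * S i‖ ≤ 1 := by
          rw [star_eq_adjoint, hS, if_pos rfl]
          exact norm_id_le
        rw [CStarRing.norm_star_mul_self] at h2
        rw [← star_eq_adjoint, norm_star]
        nlinarith
      simpa using le_of_opNorm_le _ ((norm_ampliation_le _).trans hSi) v
    refine (norm_sub_le _ _).trans ((add_le_add (h1 _) (h1 _)).trans_eq ?_)
    rw [norm_layer hS hUsum hV₀, norm_layer hS hUsum hV₀]
    ring
  · refine (hbound Z R (N * (2 * d + 2) ^ N * δ) (by positivity) fun h => ?_).trans ?_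
    · refine (norm_sum_le_of_le _ fun k hk => le_trans (norm_ampliation_layer_sub_le hS hUsum hV₀ hP
        hPS hdeg hn hUR hδ hZ hR k h) (c := (2 * d + 2) ^ N * δ * ‖h‖) ?_).trans_eq ?_
      · gcongr
        · linarith [d.cast_nonneg (α := ℝ)]
        · exact (Finset.mem_range.1 hk).le
      · rw [Finset.sum_const, Finset.card_range, nsmul_eq_mul]
        ring
    · rw [div_eq_inv_mul]
      exact mul_le_of_le_one_left (by positivity) hs1
  · refine opNorm_le_bound _ (norm_nonneg _) fun h => ?_
    rw [comp_apply, ← hnorm h]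
    refine norm_ampliation_apply_le ?_ L
    rw [hWh, map_smul, map_sum]
    simp only [ampliation_tailProj_layer hP hPS hdeg hn]

end LayerSums

section SpectralPartition

variable {F : Type*} [NormedAddCommGroup F] [InnerProductSpace ℂ F] [CompleteSpace F]

theorem inner_cfc_sum_sq (R : F →L[ℂ] F) {ι : Type*} [Fintype ι]
    {g : ι → ℝ → ℝ} (hg : ∀ j, Continuous (g j)) (h : F) :
    inner ℂ h (cfc (fun x => ∑ j, g j x ^ 2) R h) = ((∑ j, ‖cfc (g j) R h‖ ^ 2 : ℝ) : ℂ) := by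
  have h1 : cfc (fun x => ∑ j, g j x ^ 2) R = ∑ j, cfc (g j) R * cfc (g j) R := by
    have h2 : (fun x => ∑ j, g j x ^ 2) = ∑ j, fun x => g j x * g j x := by
      ext x
      simp [sq]
    rw [h2, cfc_sum (fun j x => g j x * g j x) _ _ fun j _ => ((hg j).mul (hg j)).continuousOn]
    exact Finset.sum_congr rfl fun j _ => cfc_mul _ _ _ (hg j).continuousOn (hg j).continuousOn
  rw [h1, sum_apply, inner_sum]
  push_cast
  refine Finset.sum_congr rfl fun j _ => ?_
  have h3 : adjoint (cfc (g j) R) = cfc (g j) R := IsSelfAdjoint.cfc (f := g j) (a := R)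
  change inner ℂ h (cfc (g j) R (cfc (g j) R h)) = _
  rw [← adjoint_inner_left, h3, inner_self_eq_norm_sq_to_K]
  rfl

theorem exists_spectral_partition {R : F →L[ℂ] F} (hR : IsSelfAdjoint R) {δ : ℝ} (hδ : 0 < δ) :
    ∃ (m : ℕ) (lam : Fin m → ℝ) (f : Fin m → F →L[ℂ] F), (∀ j, lam j ∈ spectrum ℝ R) ∧
      (∀ h, ∑ j, ‖f j h‖ ^ 2 = ‖h‖ ^ 2) ∧
      ∀ h, ∑ j, ‖f j (R h) - (lam j : ℂ) • f j h‖ ^ 2 ≤ (δ * ‖h‖) ^ 2 := by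
  have hcpt : IsCompact (spectrum ℝ R) := ContinuousFunctionalCalculus.isCompact_spectrum R
  obtain ⟨t, htmem, htcov⟩ := hcpt.elim_nhds_subcover (fun x => Metric.ball x δ)
    fun x _ => Metric.ball_mem_nhds x hδ
  set lam : Fin t.card → ℝ := fun j => t.equivFin.symm j with hlam
  have hcov : spectrum ℝ R ⊆ ⋃ j, Metric.ball (lam j) δ := by
    intro x hx
    obtain ⟨y, hy, hxy⟩ := Set.mem_iUnion₂.1 (htcov hx)
    exact Set.mem_iUnion.2 ⟨t.equivFin ⟨y, hy⟩, by simpa [hlam] using hxy⟩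
  obtain ⟨p, hsupp, hsum, hp, -⟩ := exists_continuous_sum_one_of_isOpen_isCompact
    (fun j => Metric.isOpen_ball (x := lam j) (ε := δ)) hcpt hcov
  have hcont : ∀ j, Continuous fun x => √(p j x) := fun j => (p j).continuous.sqrt
  have hcont' : ∀ j, Continuous fun x => √(p j x) * (x - lam j) :=
    fun j => (hcont j).mul (continuous_id.sub continuous_const)
  have hsum' : ∀ x ∈ spectrum ℝ R, ∑ j, p j x = 1 := by
    intro x hx
    simpa using hsum hx
  refine ⟨t.card, lam, fun j => cfc (fun x => √(p j x)) R,
    fun j => htmem _ (t.equivFin.symm j).2, fun h => ?_, fun h => ?_⟩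
  · have h1 := inner_cfc_sum_sq R hcont h
    rw [cfc_congr (g := fun _ => 1) fun x hx => by simp [Real.sq_sqrt (hp _ x).1, hsum' x hx],
      cfc_const_one ℝ R, one_apply_eq_self, inner_self_eq_norm_sq_to_K] at h1
    exact Complex.ofReal_injective (by simpa using h1.symm)
  · have h1 : ∀ j, cfc (fun x => √(p j x)) R (R h) - (lam j : ℂ) • cfc (fun x => √(p j x)) R h =
        cfc (fun x => √(p j x) * (x - lam j)) R h := by
      intro j
      rw [cfc_mul _ _ _ (hcont j).continuousOn, cfc_sub _ _ _, cfc_id' ℝ R, cfc_const _ R]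
      simp [Algebra.algebraMap_eq_smul_one]
    simp only [h1]
    have h2 := inner_cfc_sum_sq R hcont' h
    have h3 : ‖cfc (fun x => ∑ j, (√(p j x) * (x - lam j)) ^ 2) R‖ ≤ δ ^ 2 := by
      refine norm_cfc_le (sq_nonneg δ) fun x hx => ?_
      rw [Real.norm_of_nonneg (Finset.sum_nonneg fun j _ => sq_nonneg _)]
      calc ∑ j, (√(p j x) * (x - lam j)) ^ 2 ≤ ∑ j, p j x * δ ^ 2 := by
            refine Finset.sum_le_sum fun j _ => ?_
            rw [mul_pow, Real.sq_sqrt (hp j x).1]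
            by_cases h0 : p j x = 0
            · simp [h0]
            refine mul_le_mul_of_nonneg_left ?_ (hp j x).1
            have := hsupp j (subset_tsupport _ h0)
            rw [Metric.mem_ball, Real.dist_eq] at this
            exact sq_le_sq' (abs_le.1 this.le).1 (abs_le.1 this.le).2
        _ = δ ^ 2 := by rw [← Finset.sum_mul, hsum' x hx, one_mul]
    have h4 : ‖inner ℂ h (cfc (fun x => ∑ j, (√(p j x) * (x - lam j)) ^ 2) R h)‖ ≤
        ‖h‖ * (δ ^ 2 * ‖h‖) :=
      (norm_inner_le_norm _ _).trans
        (mul_le_mul_of_nonneg_left (le_of_opNorm_le _ h3 h) (norm_nonneg h))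
    rw [h2, Complex.norm_real] at h4
    exact (le_abs_self _).trans (h4.trans_eq (by ring))

end SpectralPartition

section Tensor

theorem lp.hasSum_norm_sq {α : Type*} {G : α → Type*} [∀ i, NormedAddCommGroup (G i)]
    (f : lp G 2) : HasSum (fun i => ‖f i‖ ^ 2) (‖f‖ ^ 2) := by
  simpa using lp.hasSum_norm (p := 2) (by simp) f

variable {E F J ι : Type*} [NormedAddCommGroup E] [InnerProductSpace ℂ E]
  [NormedAddCommGroup F] [InnerProductSpace ℂ F] [Fintype J] (b : HilbertBasis ι ℂ F)

theorem hasSum_norm_repr_smul_sq (v : J → F) (x : J → E) :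
    HasSum (fun c : J × ι => ‖b.repr (v c.1) c.2 • x c.1‖ ^ 2) (∑ j, ‖v j‖ ^ 2 * ‖x j‖ ^ 2) := by
  have h1 : ∀ j, HasSum (fun i => ‖b.repr (v j) i • x j‖ ^ 2) (‖v j‖ ^ 2 * ‖x j‖ ^ 2) := by
    intro j
    have := (lp.hasSum_norm_sq (b.repr (v j))).mul_right (‖x j‖ ^ 2)
    rw [b.repr.norm_map] at this
    simpa only [norm_smul, mul_pow] using this
  have hs : Summable fun c : J × ι => ‖b.repr (v c.1) c.2 • x c.1‖ ^ 2 :=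
    (summable_prod_of_nonneg fun c => sq_nonneg _).2
      ⟨fun j => (h1 j).summable, Summable.of_finite⟩
  convert hs.hasSum using 1
  rw [hs.tsum_prod, tsum_fintype]
  exact Finset.sum_congr rfl fun j _ => (h1 j).tsum_eq.symm

/-- The vector `∑ j, x j ⊗ v j` of the Hilbert space tensor product `E ⊗ F`, realized as a direct
sum of copies of `E` by means of an orthonormal basis of `F`. -/
def tensorVec (v : J → F) (x : J → E) : lp (fun _ : J × ι => E) 2 :=
  ⟨fun c => b.repr (v c.1) c.2 • x c.1,
    memℓp_gen (by simpa using (hasSum_norm_repr_smul_sq b v x).summable)⟩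

@[simp]
theorem tensorVec_apply (v : J → F) (x : J → E) (c : J × ι) :
    tensorVec b v x c = b.repr (v c.1) c.2 • x c.1 := rfl

theorem norm_tensorVec_sq (v : J → F) (x : J → E) :
    ‖tensorVec b v x‖ ^ 2 = ∑ j, ‖v j‖ ^ 2 * ‖x j‖ ^ 2 :=
  (lp.hasSum_norm_sq (tensorVec b v x)).unique (hasSum_norm_repr_smul_sq b v x)

theorem norm_tensorVec_le {v : J → F} {x : J → E} {c s : ℝ} (hc : 0 ≤ c) (hs : 0 ≤ s)
    (hx : ∀ j, ‖x j‖ ≤ c) (hv : ∑ j, ‖v j‖ ^ 2 ≤ s ^ 2) : ‖tensorVec b v x‖ ≤ c * s := by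
  refine le_of_sq_le_sq ?_ (mul_nonneg hc hs)
  rw [norm_tensorVec_sq, mul_pow, mul_comm]
  calc ∑ j, ‖v j‖ ^ 2 * ‖x j‖ ^ 2 ≤ ∑ j, ‖v j‖ ^ 2 * c ^ 2 := by
        gcongr with j
        exact hx j
    _ ≤ s ^ 2 * c ^ 2 := by
        rw [← Finset.sum_mul]
        gcongr

theorem exists_linearIsometry_eq_tensorVec {f : J → F →L[ℂ] F}
    (hf : ∀ h, ∑ j, ‖f j h‖ ^ 2 = ‖h‖ ^ 2) {x : J → E} (hx : ∀ j, ‖x j‖ = 1) :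
    ∃ L : F →ₗᵢ[ℂ] lp (fun _ : J × ι => E) 2, ∀ h, L h = tensorVec b (fun j => f j h) x := by
  let L : F →ₗ[ℂ] lp (fun _ : J × ι => E) 2 :=
    { toFun := fun h => tensorVec b (fun j => f j h) x
      map_add' := fun g h => by
        ext c
        simp [add_smul]
      map_smul' := fun a h => by
        ext c
        simp [mul_smul] }
  have hL : ∀ h, L h = tensorVec b (fun j => f j h) x := fun _ => rfl
  refine ⟨⟨L, fun h => ?_⟩, hL⟩
  rw [hL, ← sq_eq_sq₀ (norm_nonneg _) (norm_nonneg h), norm_tensorVec_sq, ← hf h]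
  simp only [hx, one_pow, mul_one]

end Tensor

theorem exists_bottom_layer {E F : Type*} [NormedAddCommGroup E] [InnerProductSpace ℂ E]
    [CompleteSpace E] [NormedAddCommGroup F] [InnerProductSpace ℂ F] [CompleteSpace F]
    {P : ℕ → (E →L[ℂ] E)} (hP : IsGrading P) {Z : E →L[ℂ] E} (hZ : adjoint Z = Z)
    (hZP : ∀ k, Z * P k = P k * Z) {R : F →L[ℂ] F} (hR : IsSelfAdjoint R)
    (hspec : spectrum ℂ R ⊆ {lam : ℂ | ¬ ∃ V : E →L[ℂ] E,
      IsCompactOperator ⇑((Z - lam • 1) * V - 1) ∧ IsCompactOperator ⇑(V * (Z - lam • 1) - 1)})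
    (n : ℕ) {δ : ℝ} (hδ : 0 < δ) :
    ∃ (m : ℕ) (ι : Set F) (deg : Fin m × ι → ℕ) (V₀ : F →L[ℂ] lp (fun _ : Fin m × ι => E) 2),
      (∀ g h, inner ℂ (V₀ g) (V₀ h) = inner ℂ g h) ∧ (∀ h c, P (deg c) (V₀ h c) = V₀ h c) ∧
      (∀ c, n ≤ deg c) ∧ ∀ h, ‖ampliation (Fin m × ι) Z (V₀ h) - V₀ (R h)‖ ≤ δ * ‖h‖ := by
  obtain ⟨m, lam, f, hlam, hf, hfR⟩ := exists_spectral_partition hR (half_pos hδ)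
  have hex : ∀ j, ∃ k x, n ≤ k ∧ P k x = x ∧ ‖x‖ = 1 ∧ ‖Z x - (lam j : ℂ) • x‖ ≤ δ / 2 :=
    fun j => hP.exists_approx_eigenvector hZ hZP
      (hspec ((spectrum.algebraMap_mem_iff ℂ (R := ℝ)).2 (hlam j))) n (half_pos hδ)
  choose k x hk hPx hx hZx using hex
  obtain ⟨ι, b, -⟩ := exists_hilbertBasis ℂ F
  obtain ⟨L, hLh⟩ := exists_linearIsometry_eq_tensorVec b hf hx
  refine ⟨m, ι, fun c => k c.1, L.toContinuousLinearMap, L.inner_map_map, fun h c => ?_,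
    fun c => hk c.1, fun h => ?_⟩
  · rw [LinearIsometry.coe_toContinuousLinearMap, hLh, tensorVec_apply, map_smul, hPx]
  · rw [LinearIsometry.coe_toContinuousLinearMap, hLh, hLh]
    have key : ampliation (Fin m × ι) Z (tensorVec b (fun j => f j h) x) -
        tensorVec b (fun j => f j (R h)) x =
        tensorVec b (fun j => f j h) (fun j => Z (x j) - (lam j : ℂ) • x j) -
          tensorVec b (fun j => f j (R h) - (lam j : ℂ) • f j h) x := by
      ext c
      have h1 : b.repr (f c.1 (R h) - (lam c.1 : ℂ) • f c.1 h) c.2 =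
          b.repr (f c.1 (R h)) c.2 - b.repr (f c.1 h) c.2 * (lam c.1 : ℂ) := by
        rw [map_sub, map_smul, mul_comm]
        rfl
      change Z (b.repr (f c.1 h) c.2 • x c.1) - b.repr (f c.1 (R h)) c.2 • x c.1 =
        b.repr (f c.1 h) c.2 • (Z (x c.1) - (lam c.1 : ℂ) • x c.1) -
          b.repr (f c.1 (R h) - (lam c.1 : ℂ) • f c.1 h) c.2 • x c.1
      rw [h1, map_smul, sub_smul, smul_sub, mul_smul]
      abel
    rw [key]
    have h1 := norm_tensorVec_le b (half_pos hδ).le (norm_nonneg h) hZx (hf h).le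
    have h2 := norm_tensorVec_le b zero_le_one (by positivity) (fun j => (hx j).le) (hfR h)
    linarith [norm_sub_le (tensorVec b (fun j => f j h) (fun j => Z (x j) - (lam j : ℂ) • x j))
      (tensorVec b (fun j => f j (R h) - (lam j : ℂ) • f j h) x)]

section Representation

variable {E F : Type*} [NormedAddCommGroup E] [InnerProductSpace ℂ E] [CompleteSpace E]
  [NormedAddCommGroup F] [InnerProductSpace ℂ F] [CompleteSpace F] {d : ℕ}
  {S : Fin d → (E →L[ℂ] E)} {U : Fin d → (F →L[ℂ] F)} {P : ℕ → (E →L[ℂ] E)}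
  {Z : E →L[ℂ] E} {R : F →L[ℂ] F}

theorem exists_almost_intertwiner (hS : ∀ i j, adjoint (S i) * S j = if i = j then 1 else 0)
    (hP : IsGrading P) (hPS : ∀ m i, P (m + 1) * S i = S i * P m)
    (hZ : adjoint Z = Z) (hZP : ∀ k, Z * P k = P k * Z)
    (hSZ : ∀ i, IsCompactOperator ⇑(S i * Z - Z * S i))
    (hU : ∀ i j, adjoint (U i) * U j = if i = j then 1 else 0)
    (hUsum : ∑ i, U i * adjoint (U i) = 1) (hR : IsSelfAdjoint R)
    (hRU : ∀ i, R * U i = U i * R)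
    (hspec : spectrum ℂ R ⊆ {lam : ℂ | ¬ ∃ V : E →L[ℂ] E,
      IsCompactOperator ⇑((Z - lam • 1) * V - 1) ∧ IsCompactOperator ⇑(V * (Z - lam • 1) - 1)})
    (n : ℕ) :
    ∃ (m : ℕ) (ι : Set F) (W : F →L[ℂ] lp (fun _ : Fin m × ι => E) 2), (∀ h, ‖W h‖ = ‖h‖) ∧
      (∀ i, ‖ampliation (Fin m × ι) (S i) ∘L W - W ∘L U i‖ ≤ 2 / √((n + 1 : ℕ) : ℝ)) ∧
      (∀ i, ‖ampliation (Fin m × ι) (adjoint (S i)) ∘L W - W ∘L adjoint (U i)‖ ≤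
        2 / √((n + 1 : ℕ) : ℝ)) ∧
      ‖ampliation (Fin m × ι) Z ∘L W - W ∘L R‖ ≤ 1 / ((n + 1 : ℕ) : ℝ) ∧
      ∀ L : E →L[ℂ] E, ‖ampliation (Fin m × ι) L ∘L W‖ ≤ ‖L * tailProj P n‖ := by
  have hUR : ∀ i, adjoint (U i) * R = R * adjoint (U i) := by
    intro i
    have := congrArg star (hRU i)
    rwa [star_mul, star_mul, hR.star_eq] at this
  set c : ℝ := ((n + 1 : ℕ) : ℝ) * (2 * d + 2) ^ (n + 1) with hc
  have hc0 : 0 < c := by positivity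
  set δ : ℝ := 1 / ((n + 1 : ℕ) : ℝ) / c with hδdef
  have hδ : 0 < δ := by positivity
  obtain ⟨p, hp, hnp⟩ := ((Filter.eventually_all.2 fun i =>
    (hP.tendsto_mul_tailProj (hSZ i)).eventually_le_const hδ).and (eventually_ge_atTop n)).exists
  obtain ⟨m, ι, deg, V₀, hV₀, hdeg, hn, hV₀R⟩ := exists_bottom_layer hP hZ hZP hR hspec p hδ
  obtain ⟨W, h1, h2, h3, h4, h5⟩ := exists_isometry_of_layer hS hU hUsum hV₀ hP hPS hdeg hn hUR
    hδ.le hp hV₀R n.succ_pos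
  refine ⟨m, ι, W, h1, h2, h3, h4.trans_eq ?_, fun L => (h5 L).trans ?_⟩
  · rw [hδdef, ← hc]
    exact mul_div_cancel₀ _ hc0.ne'
  · rw [← hP.tailProj_mul_tailProj hnp, ← mul_assoc]
    exact (norm_mul_le _ _).trans
      (mul_le_of_le_one_right (norm_nonneg _) (hP.norm_tailProj_le p))

/-- A Cuntz family together with a commuting self-adjoint operator whose spectrum consists of
essential spectral values of `Z` gives a representation that vanishes on the compact operators. -/
theorem exists_representation (hS : ∀ i j, adjoint (S i) * S j = if i = j then 1 else 0)
    (hP : IsGrading P) (hPS : ∀ m i, P (m + 1) * S i = S i * P m)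
    (hZ : adjoint Z = Z) (hZP : ∀ k, Z * P k = P k * Z)
    (hSZ : ∀ i, IsCompactOperator ⇑(S i * Z - Z * S i))
    (hU : ∀ i j, adjoint (U i) * U j = if i = j then 1 else 0)
    (hUsum : ∑ i, U i * adjoint (U i) = 1) (hR : IsSelfAdjoint R)
    (hRU : ∀ i, R * U i = U i * R)
    (hspec : spectrum ℂ R ⊆ {lam : ℂ | ¬ ∃ V : E →L[ℂ] E,
      IsCompactOperator ⇑((Z - lam • 1) * V - 1) ∧ IsCompactOperator ⇑(V * (Z - lam • 1) - 1)})
    {T : StarSubalgebra ℂ (E →L[ℂ] E)}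
    (hT : T = (StarAlgebra.adjoin ℂ (Set.range fun i => Z * S i)).topologicalClosure) :
    ∃ π : T →⋆ₐ[ℂ] (F →L[ℂ] F), (∀ X (hX : X ∈ T), IsCompactOperator ⇑X → π ⟨X, hX⟩ = 0) ∧
      (∀ i (hi : S i ∈ T), π ⟨S i, hi⟩ = U i) ∧ ∀ hi : Z ∈ T, π ⟨Z, hi⟩ = R := by
  choose m ι W hW hWS hWSa hWZ hWL using
    exists_almost_intertwiner hS hP hPS hZ hZP hSZ hU hUsum hR hRU hspec
  have hρ : ∀ n (X : E →L[ℂ] E), ‖ampliation (Fin (m n) × ι n) X‖ ≤ ‖X‖ :=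
    fun n X => norm_ampliation_le X
  have hlim : Tendsto (fun n : ℕ => 2 / √((n + 1 : ℕ) : ℝ)) atTop (𝓝 0) :=
    ((Real.tendsto_sqrt_atTop.comp tendsto_natCast_atTop_atTop).comp
      (tendsto_add_atTop_nat 1)).const_div_atTop 2
  have aS : ∀ i, AsympIntertwines (fun n => ampliation (Fin (m n) × ι n)) W (S i) (U i) :=
    fun i => squeeze_zero (fun _ => norm_nonneg _) (fun n => hWS n i) hlim
  have aSa : ∀ i, AsympIntertwines (fun n => ampliation (Fin (m n) × ι n)) W (adjoint (S i))
      (adjoint (U i)) :=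
    fun i => squeeze_zero (fun _ => norm_nonneg _) (fun n => hWSa n i) hlim
  have aZ : AsympIntertwines (fun n => ampliation (Fin (m n) × ι n)) W Z R :=
    squeeze_zero (fun _ => norm_nonneg _) hWZ
      ((tendsto_natCast_atTop_atTop.comp (tendsto_add_atTop_nat 1)).const_div_atTop 1)
  have aK : ∀ X : E →L[ℂ] E, IsCompactOperator ⇑X →
      AsympIntertwines (fun n => ampliation (Fin (m n) × ι n)) W X 0 :=
    fun X hX => squeeze_zero (fun _ => norm_nonneg _)
      (fun n => by simpa using hWL n X) (hP.tendsto_mul_tailProj hX)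
  obtain ⟨π, hπ⟩ := AsympIntertwines.exists_starAlgHom hρ hW hT (by
    rintro _ ⟨i, rfl⟩
    refine ⟨R * U i, aZ.mul hρ (aS i), ?_⟩
    rw [star_mul, star_mul, star_eq_adjoint Z, hZ, hR.star_eq]
    exact (aSa i).mul hρ aZ)
  exact ⟨π, fun X hX hc => (hπ ⟨X, hX⟩).unique hρ hW (aK X hc),
    fun i hi => (hπ ⟨S i, hi⟩).unique hρ hW (aS i), fun hi => (hπ ⟨Z, hi⟩).unique hρ hW aZ⟩

end Representation

section Quotient

variable {E F : Type*} [NormedAddCommGroup E] [InnerProductSpace ℂ E] [CompleteSpace E]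
  [NormedAddCommGroup F] [InnerProductSpace ℂ F] [CompleteSpace F]
  {T : StarSubalgebra ℂ (E →L[ℂ] E)}

theorem inner_smul_adjoint_mul_sub_left (c : ℝ) (A B : E →L[ℂ] E) (x : E) :
    inner ℂ (((c : ℂ) • (adjoint A * A) - adjoint B * B) x) x =
      ((c * ‖A x‖ ^ 2 - ‖B x‖ ^ 2 : ℝ) : ℂ) := by
  rw [sub_apply, smul_apply, inner_sub_left, inner_smul_left, mul_def, mul_def, comp_apply,
    comp_apply, adjoint_inner_left, adjoint_inner_left, inner_self_eq_norm_sq_to_K,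
    inner_self_eq_norm_sq_to_K, Complex.conj_ofReal]
  push_cast
  rfl

theorem isPositive_map_of_isClosed (hT : IsClosed (T : Set (E →L[ℂ] E)))
    (π : T →⋆ₐ[ℂ] (F →L[ℂ] F)) (X : T) (hX : (X : E →L[ℂ] E).IsPositive) : (π X).IsPositive := by
  obtain ⟨X, hXT⟩ := X
  have hX0 : 0 ≤ X := (nonneg_iff_isPositive _).2 hX
  have := hT
  have hmem : cfc Real.sqrt X ∈ T := cfc_mem (𝕜' := ℂ) Real.sqrt hXT
  have hsa : star (cfc Real.sqrt X) = cfc Real.sqrt X := IsSelfAdjoint.cfc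
  have hsq : X = star (cfc Real.sqrt X) * cfc Real.sqrt X := by
    rw [hsa, ← cfc_mul _ _ _, cfc_congr (g := id), cfc_id ℝ X]
    intro x hx
    exact Real.mul_self_sqrt (spectrum_nonneg_of_nonneg hX0 hx)
  have hY : (⟨X, hXT⟩ : T) = star ⟨cfc Real.sqrt X, hmem⟩ * ⟨cfc Real.sqrt X, hmem⟩ :=
    Subtype.ext hsq
  rw [hY, map_mul, map_star]
  exact isPositive_adjoint_comp_self _

theorem isUnit_map_of_inverse_mod_compact (hT : IsClosed (T : Set (E →L[ℂ] E)))
    (hK : ∀ X : E →L[ℂ] E, IsCompactOperator ⇑X → X ∈ T) (π : T →⋆ₐ[ℂ] (F →L[ℂ] F))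
    (hπ : ∀ X (hX : X ∈ T), IsCompactOperator ⇑X → π ⟨X, hX⟩ = 0) (A : T)
    (hA : Commute (star A) A) {V : E →L[ℂ] E} (hV : IsCompactOperator ⇑(V * A - 1)) :
    IsUnit (π A) := by
  set k : T := ⟨V * A - 1, hK _ hV⟩ with hk
  have hk0 : π k = 0 := hπ _ _ hV
  have hk1 : ((1 + k : T) : E →L[ℂ] E) = V * A := by
    simp [hk]
  set c : ℝ := ‖V‖ ^ 2 + 1 with hc
  have hc0 : 0 < c := by positivity
  set M : T := (c : ℂ) • (star A * A) - star (1 + k) * (1 + k) with hM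
  have hM1 : (M : E →L[ℂ] E) = (c : ℂ) • (adjoint (A : E →L[ℂ] E) * (A : E →L[ℂ] E)) -
      adjoint (V * (A : E →L[ℂ] E)) * (V * (A : E →L[ℂ] E)) := by
    rw [← hk1]
    rfl
  have hpos : (M : E →L[ℂ] E).IsPositive := by
    rw [isPositive_iff_complex]
    intro x
    rw [hM1, inner_smul_adjoint_mul_sub_left, RCLike.re_to_complex, Complex.ofReal_re]
    refine ⟨rfl, sub_nonneg.2 ?_⟩
    have h1 := pow_le_pow_left₀ (norm_nonneg _) (V.le_opNorm ((A : E →L[ℂ] E) x)) 2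
    rw [mul_pow] at h1
    refine h1.trans (mul_le_mul_of_nonneg_right ?_ (sq_nonneg _))
    rw [hc]
    exact le_add_of_nonneg_right zero_le_one
  have hπM : (π M).IsPositive := isPositive_map_of_isClosed hT π M hpos
  have hπM' : π M = (c : ℂ) • (adjoint (π A) * π A) -
      adjoint (1 : F →L[ℂ] F) * 1 := by
    rw [hM, map_sub, map_smul, map_mul, map_mul, map_star, map_star, map_add, map_one, hk0,
      add_zero, star_eq_adjoint, star_eq_adjoint]
  refine isUnit_of_commute_star_of_le (c := c⁻¹) ?_ (by positivity) fun x => ?_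
  · have := hA.map π
    rwa [map_star] at this
  · have h1 := hπM.re_inner_nonneg_left x
    rw [hπM', inner_smul_adjoint_mul_sub_left, RCLike.re_to_complex, Complex.ofReal_re,
      one_apply_eq_self, sub_nonneg] at h1
    rwa [inv_mul_le_iff₀ hc0]

end Quotient

open ContinuousLinearMap in
theorem statement19 (d : ℕ) (hd : 1 ≤ d)
    (S : Fin d → (FockSpace d →L[ℂ] FockSpace d))
    (hS : ∀ (i : Fin d) (α : FreeMonoid (Fin d)),
      S i (fockBasis d α) = fockBasis d (FreeMonoid.of i * α))
    (P : ℕ → (FockSpace d →L[ℂ] FockSpace d))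
    (hP : ∀ (k : ℕ) (α : FreeMonoid (Fin d)),
      P k (fockBasis d α) = if α.length = k then fockBasis d α else 0)
    (Z : FockSpace d →L[ℂ] FockSpace d)
    (hZinv : IsUnit Z)
    (hZpos : Z.IsPositive)
    (hZP : ∀ k : ℕ, Z * P k = P k * Z)
    (hZ0 : Z * P 0 = P 0)
    (hA1 : ∀ i : Fin d, IsCompactOperator ⇑(S i * Z - Z * S i))
    (T : StarSubalgebra ℂ (FockSpace d →L[ℂ] FockSpace d))
    (hT : T = (StarAlgebra.adjoin ℂ (Set.range fun i => Z * S i)).topologicalClosure)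
    (hKT : ∀ X : FockSpace d →L[ℂ] FockSpace d, IsCompactOperator ⇑X → X ∈ T)
    (hST : ∀ i : Fin d, S i ∈ T) (hZT : Z ∈ T)
    (H' : Type) [NormedAddCommGroup H'] [InnerProductSpace ℂ H'] [CompleteSpace H']
    (U : Fin d → (H' →L[ℂ] H')) (R : H' →L[ℂ] H') :
    (∃ π : T →⋆ₐ[ℂ] (H' →L[ℂ] H'),
        (∀ (X : FockSpace d →L[ℂ] FockSpace d) (hX : X ∈ T),
          IsCompactOperator ⇑X → π ⟨X, hX⟩ = 0) ∧
        (∀ i : Fin d, π ⟨S i, hST i⟩ = U i) ∧ π ⟨Z, hZT⟩ = R) ↔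
      ((∀ i j : Fin d, adjoint (U i) * U j = if i = j then 1 else 0) ∧
        (∑ i : Fin d, U i * adjoint (U i)) = 1 ∧
        R.IsPositive ∧ IsUnit R ∧ (∀ i : Fin d, R * U i = U i * R) ∧
        spectrum ℂ R ⊆ {lam : ℂ |
          ¬ ∃ V : FockSpace d →L[ℂ] FockSpace d,
            IsCompactOperator ⇑((Z - lam • 1) * V - 1) ∧
            IsCompactOperator ⇑(V * (Z - lam • 1) - 1)}) := by
  have hP' : IsGrading P := isGrading_of_fockBasis hP
  have hZsa : adjoint Z = Z := hZpos.isSelfAdjoint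
  have hTc : IsClosed (T : Set (FockSpace d →L[ℂ] FockSpace d)) := by
    rw [hT]
    exact StarSubalgebra.isClosed_topologicalClosure _
  constructor
  · rintro ⟨π, hπK, hπS, hπZ⟩
    set s : Fin d → T := fun i => ⟨S i, hST i⟩ with hs
    set z : T := ⟨Z, hZT⟩ with hz
    have hπP : π ⟨P 0, hKT _ (proj_isCompact hP 0)⟩ = 0 := hπK _ _ (proj_isCompact hP 0)
    refine ⟨fun i j => ?_, ?_, ?_, ?_, fun i => ?_, fun lam hlam => ?_⟩
    · have h1 : star (s i) * s j = if i = j then 1 else 0 := by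
        refine Subtype.ext ((creation_adjoint_mul hS i j).trans ?_)
        split_ifs <;> rfl
      have h2 := congrArg π h1
      rw [map_mul, map_star, hπS, hπS, star_eq_adjoint] at h2
      rw [h2]
      split_ifs <;> simp
    · have h1 : 1 - ∑ i, s i * star (s i) = ⟨P 0, hKT _ (proj_isCompact hP 0)⟩ := by
        refine Subtype.ext (Eq.trans ?_ (one_sub_sum_creation hS hP))
        change T.subtype (1 - ∑ i, s i * star (s i)) = _
        rw [map_sub, map_one, map_sum]
        rfl
      have h2 := congrArg π h1
      rw [hπP, map_sub, map_one, map_sum, sub_eq_zero] at h2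
      rw [h2]
      refine Finset.sum_congr rfl fun i _ => ?_
      rw [map_mul, map_star, hπS, star_eq_adjoint]
    · rw [← hπZ]
      exact isPositive_map_of_isClosed hTc π z hZpos
    · obtain ⟨u, hu⟩ := hZinv
      rw [← hπZ]
      refine isUnit_map_of_inverse_mod_compact hTc hKT π hπK z ?_ (V := ↑u⁻¹) ?_
      · have : star z = z := Subtype.ext hZsa
        rw [this]
      · have : (↑u⁻¹ * Z - 1 : FockSpace d →L[ℂ] FockSpace d) = 0 := by
          rw [← hu, Units.inv_mul, sub_self]
        rw [this]
        exact isCompactOperator_zero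
    · have h1 : π (s i * z - z * s i) = 0 := hπK _ (sub_mem (mul_mem (hST i) hZT)
        (mul_mem hZT (hST i))) (hA1 i)
      rw [map_sub, map_mul, map_mul, hπS, hπZ, sub_eq_zero] at h1
      exact h1.symm
    · rintro ⟨V, -, hV⟩
      have h1 : IsUnit (π (z - lam • 1)) := by
        refine isUnit_map_of_inverse_mod_compact hTc hKT π hπK _ ?_ hV
        have : star z = z := Subtype.ext hZsa
        rw [star_sub, star_smul, star_one, this]
        exact ((Commute.refl z).sub_left ((Commute.one_left z).smul_left _)).sub_right
          ((Commute.one_right _).smul_right _)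
      rw [map_sub, map_smul, map_one, hπZ] at h1
      refine spectrum.mem_iff.1 hlam ?_
      rw [Algebra.algebraMap_eq_smul_one, ← neg_sub]
      exact h1.neg
  · rintro ⟨hU, hUsum, hR, -, hRU, hspec⟩
    obtain ⟨π, h1, h2, h3⟩ := exists_representation (creation_adjoint_mul hS) hP'
      (proj_succ_mul_creation hS hP) hZsa hZP hA1 hU hUsum hR.isSelfAdjoint hRU hspec hT
    exact ⟨π, h1, fun i => h2 i (hST i), h3 hZT⟩
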